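/- Blackwell's characterisation, absorbing-state specialisation (Theorem 5.1, as used in the paper): Let S be a countable set with the discrete σ-algebra, K : S → PMF(S) a transition function, and s₀ ∈ S absorbing, i.e. K(s₀) is the point mass at s₀. Then the following are equivalent: (a) for every s ∈ S, every Markov chain X with kernel K started at s satisfies ℙ(∃ n, X_n = s₀) = 1; (b) every bounded function V : S → ℝ that is harmonic at every s ≠ s₀ (i.e. ∑_{t∈S} K(s)(t)·V(t) = V(s) for all s ≠ s₀) is constant on S. -/

import Mathlib

open MeasureTheory Filter

/-- A Markov chain with kernel `K` started at `s`: an adapted process with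
`X 0 = s` a.s. and one-step transition probabilities given by `K`. -/
def IsMarkovChain {S : Type} [MeasurableSpace S]
    {Ω : Type} {m : MeasurableSpace Ω} (μ : Measure Ω) (ℱ : Filtration ℕ m)
    (K : S → PMF S) (s : S) (X : ℕ → Ω → S) : Prop :=
  (∀ n, Measurable[ℱ n] (X n)) ∧ (∀ᵐ ω ∂μ, X 0 ω = s) ∧
    ∀ (n : ℕ) (t : S), ∀ᵐ ω ∂μ,
      (μ[Set.indicator {ω' | X (n + 1) ω' = t} (fun _ => (1 : ℝ)) | ℱ n]) ω
        = ((K (X n ω)) t).toReal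

/-- The distribution after `n` steps of the chain with kernel `K` started at `s`. -/
noncomputable def stepDist {S : Type} (K : S → PMF S) : ℕ → S → PMF S
  | 0 => PMF.pure
  | n + 1 => fun s => (K s).bind (stepDist K n)

lemma stepDist_succ_eq_bind {S : Type} (K : S → PMF S) (n : ℕ) (s : S) :
    stepDist K (n + 1) s = (stepDist K n s).bind K := by
  induction n generalizing s with
  | zero => simp [stepDist]
  | succ n ih =>
    change (K s).bind (stepDist K (n + 1)) = ((K s).bind (stepDist K n)).bind K
    rw [PMF.bind_bind]
    exact congrArg _ (funext ih)

lemma stepDist_absorbing_mono {S : Type} {K : S → PMF S} {s₀ : S}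
    (habs : K s₀ = PMF.pure s₀) (s : S) : Monotone fun n => stepDist K n s s₀ := by
  refine monotone_nat_of_le_succ fun n => ?_
  rw [stepDist_succ_eq_bind, PMF.bind_apply]
  refine le_trans ?_ (ENNReal.le_tsum s₀)
  simp [habs]

lemma stepDist_absorbing {S : Type} {K : S → PMF S} {s₀ : S}
    (habs : K s₀ = PMF.pure s₀) (n : ℕ) : stepDist K n s₀ = PMF.pure s₀ := by
  induction n with
  | zero => rfl
  | succ n ih => simp [stepDist, habs, ih]

lemma tsum_stepDist_mul_of_harmonic {S : Type} {K : S → PMF S} {W : S → ENNReal}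
    (hW : ∀ s, ∑' t, K s t * W t = W s) (n : ℕ) (s : S) :
    ∑' t, stepDist K n s t * W t = W s := by
  induction n generalizing s with
  | zero =>
    rw [tsum_eq_single s]
    · simp [stepDist]
    · intro t ht
      simp [stepDist, ht]
  | succ n ih =>
    simp_rw [stepDist, PMF.bind_apply, ← ENNReal.tsum_mul_right]
    rw [ENNReal.tsum_comm]
    simp_rw [mul_assoc, ENNReal.tsum_mul_left, ih]
    exact hW s

lemma tsum_mul_iSup_stepDist {S : Type} {K : S → PMF S} {s₀ : S}
    (habs : K s₀ = PMF.pure s₀) (s : S) :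
    ∑' t, K s t * ⨆ n, stepDist K n t s₀ = ⨆ n, stepDist K n s s₀ := by
  let _ : MeasurableSpace S := ⊤
  have hmono := fun t => stepDist_absorbing_mono habs t
  simp_rw [ENNReal.mul_iSup]
  rw [← lintegral_count, lintegral_iSup (fun _ => measurable_from_top)]
  · simp_rw [lintegral_count]
    exact (hmono s).iSup_nat_add 1
  · exact fun m n hmn t => mul_le_mul_right (hmono t hmn) _

lemma PMF.summable_toReal {S : Type} (p : PMF S) : Summable fun t => (p t).toReal :=
  ENNReal.summable_toReal p.tsum_coe_ne_top

lemma PMF.tsum_mul_ofReal_add {S : Type} (p : PMF S) {V : S → ℝ} {C : ℝ}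
    (hC : ∀ t, |V t| ≤ C) :
    ∑' t, p t * ENNReal.ofReal (V t + C)
      = ENNReal.ofReal (∑' t, (p t).toReal * V t + C) := by
  have hp1 : ∑' t, (p t).toReal = 1 := by
    rw [← ENNReal.tsum_toReal_eq p.apply_ne_top, p.tsum_coe, ENNReal.toReal_one]
  have hs : Summable fun t => (p t).toReal * V t :=
    .of_norm_bounded (p.summable_toReal.mul_right C) fun t => by
      rw [norm_mul, Real.norm_of_nonneg ENNReal.toReal_nonneg]
      exact mul_le_mul_of_nonneg_left (hC t) ENNReal.toReal_nonneg
  have hsum : ∑' t, (p t).toReal * (V t + C) = ∑' t, (p t).toReal * V t + C := by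
    simp_rw [mul_add]
    rw [hs.tsum_add (p.summable_toReal.mul_right C), tsum_mul_right, hp1, one_mul]
  rw [← hsum, ENNReal.ofReal_tsum_of_nonneg]
  · refine tsum_congr fun t => ?_
    rw [ENNReal.ofReal_mul ENNReal.toReal_nonneg, ENNReal.ofReal_toReal (p.apply_ne_top t)]
  · exact fun t => mul_nonneg ENNReal.toReal_nonneg (by linarith [neg_abs_le (V t), hC t])
  · simp_rw [mul_add]
    exact hs.add (p.summable_toReal.mul_right C)

lemma le_of_harmonic_of_iSup_stepDist_eq_one {S : Type} {K : S → PMF S} {s₀ s : S}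
    (hit : ⨆ n, stepDist K n s s₀ = 1) {V : S → ℝ} {C : ℝ} (hC : ∀ t, |V t| ≤ C)
    (hV : ∀ s, ∑' t, (K s t).toReal * V t = V s) : V s₀ ≤ V s := by
  have hpos : ∀ t, 0 ≤ V t + C := fun t => by linarith [neg_abs_le (V t), hC t]
  have hW : ∀ s, ∑' t, K s t * ENNReal.ofReal (V t + C) = ENNReal.ofReal (V s + C) := fun s => by
    rw [PMF.tsum_mul_ofReal_add _ hC, hV]
  have hle : ENNReal.ofReal (V s₀ + C) ≤ ENNReal.ofReal (V s + C) := by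
    rw [← one_mul (ENNReal.ofReal (V s₀ + C)), ← hit, ENNReal.iSup_mul]
    refine iSup_le fun n => ?_
    rw [← tsum_stepDist_mul_of_harmonic hW n s]
    exact ENNReal.le_tsum (f := fun t => stepDist K n s t * ENNReal.ofReal (V t + C)) s₀
  linarith [(ENNReal.ofReal_le_ofReal_iff (hpos s)).1 hle]

namespace IsMarkovChain

variable {S : Type} [MeasurableSpace S] {Ω : Type} {m : MeasurableSpace Ω} {μ : Measure Ω}
  {ℱ : Filtration ℕ m} {K : S → PMF S} {s : S} {X : ℕ → Ω → S}

lemma measurable (h : IsMarkovChain μ ℱ K s X) (n : ℕ) : Measurable (X n) :=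
  (h.1 n).mono (ℱ.le n) le_rfl

variable [Countable S] [DiscreteMeasurableSpace S] [IsProbabilityMeasure μ]

lemma measure_inter_succ_eq (h : IsMarkovChain μ ℱ K s X) {n : ℕ} {A : Set Ω}
    (hA : MeasurableSet[ℱ n] A) (t : S) :
    μ (A ∩ {ω | X (n + 1) ω = t}) = ∫⁻ ω in A, K (X n ω) t ∂μ := by
  have hB : MeasurableSet {ω | X (n + 1) ω = t} := h.measurable (n + 1) (.singleton t)
  have hK : Measurable fun ω => K (X n ω) t :=
    (measurable_of_countable fun s => K s t).comp (h.measurable n)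
  have hset := setIntegral_condExp (ℱ.le n)
    ((integrable_const (μ := μ) (1 : ℝ)).indicator hB) hA
  rw [setIntegral_congr_ae (ℱ.le n A hA) ((h.2.2 n t).mono fun _ hω _ => hω),
    integral_toReal hK.aemeasurable (.of_forall fun ω => (K (X n ω)).apply_lt_top t),
    setIntegral_indicator hB, setIntegral_const, smul_eq_mul, mul_one] at hset
  refine ((ENNReal.toReal_eq_toReal_iff' ?_ (measure_ne_top _ _)).1 hset).symm
  refine ne_top_of_le_ne_top (measure_ne_top μ A) ?_
  calc ∫⁻ ω in A, K (X n ω) t ∂μ ≤ ∫⁻ _ in A, 1 ∂μ :=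
        lintegral_mono fun ω => (K (X n ω)).coe_le_one t
    _ = μ A := by simp

lemma measure_eq_stepDist (h : IsMarkovChain μ ℱ K s X) (n : ℕ) (t : S) :
    μ {ω | X n ω = t} = stepDist K n s t := by
  induction n generalizing t with
  | zero =>
    by_cases hts : t = s
    · subst hts
      rw [measure_congr (eventuallyEq_univ.2 h.2.1), measure_univ]
      simp [stepDist]
    · rw [measure_eq_zero_iff_ae_notMem.2]
      · simp [stepDist, hts]
      · filter_upwards [h.2.1] with ω hω hω'
        exact hts (hω'.symm.trans hω)
  | succ n ih =>
    have hstep := h.measure_inter_succ_eq (n := n) MeasurableSet.univ t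
    rw [Set.univ_inter, Measure.restrict_univ] at hstep
    rw [hstep, stepDist_succ_eq_bind, PMF.bind_apply,
      ← lintegral_map (f := fun s => K s t) (measurable_of_countable _) (h.measurable n),
      lintegral_countable']
    refine tsum_congr fun u => ?_
    rw [Measure.map_apply (h.measurable n) (.singleton u), mul_comm, ← ih u]
    rfl

lemma ae_eq_absorbing_of_le (h : IsMarkovChain μ ℱ K s X) {s₀ : S}
    (habs : K s₀ = PMF.pure s₀) :
    ∀ᵐ ω ∂μ, ∀ k n, k ≤ n → X k ω = s₀ → X n ω = s₀ := by
  have hstep : ∀ᵐ ω ∂μ, ∀ n, X n ω = s₀ → X (n + 1) ω = s₀ := by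
    refine ae_all_iff.2 fun n => ?_
    have hA : MeasurableSet[ℱ n] {ω | X n ω = s₀} := h.1 n (.singleton s₀)
    have hB : MeasurableSet {ω | X (n + 1) ω = s₀} := h.measurable (n + 1) (.singleton s₀)
    have hmeas := h.measure_inter_succ_eq hA s₀
    rw [setLIntegral_congr_fun (g := fun _ => 1) (ℱ.le n _ hA)
      (fun ω (hω : X n ω = s₀) => by simp [hω, habs]), setLIntegral_one] at hmeas
    have hae := ae_eq_of_subset_of_measure_ge (μ := μ) Set.inter_subset_left hmeas.ge
      ((ℱ.le n _ hA).inter hB).nullMeasurableSet (measure_ne_top _ _)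
    filter_upwards [hae.mem_iff] with ω hω hX
    exact (hω.2 hX).2
  filter_upwards [hstep] with ω hω k n hkn hk
  induction n, hkn using Nat.le_induction with
  | base => exact hk
  | succ n _ ih => exact hω n ih

lemma measure_exists_eq_iSup (h : IsMarkovChain μ ℱ K s X) {s₀ : S}
    (habs : K s₀ = PMF.pure s₀) :
    μ {ω | ∃ n, X n ω = s₀} = ⨆ n, stepDist K n s s₀ := by
  have hU : {ω | ∃ n, X n ω = s₀} = ⋃ n, {ω | X n ω = s₀} := by ext; simp
  rw [hU]
  apply le_antisymm
  · rw [measure_iUnion_eq_iSup_accumulate]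
    refine iSup_mono fun n => ?_
    rw [← h.measure_eq_stepDist n s₀]
    refine measure_mono_ae ?_
    filter_upwards [h.ae_eq_absorbing_of_le habs] with ω hω hmem
    obtain ⟨k, hkn, hk⟩ := Set.mem_accumulate.1 hmem
    exact hω k n hkn hk
  · refine iSup_le fun n => ?_
    rw [← h.measure_eq_stepDist n s₀]
    exact measure_mono (Set.subset_iUnion (fun n => {ω | X n ω = s₀}) n)

end IsMarkovChain

/-- A kernel on a countable space has a Markov chain from every starting point, realised as the
coordinate process on the space of trajectories. -/
lemma exists_isMarkovChain {S : Type} [Countable S] [MeasurableSpace S]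
    [DiscreteMeasurableSpace S] (K : S → PMF S) (s : S) :
    ∃ (μ : Measure (ℕ → S)) (ℱ : Filtration ℕ MeasurableSpace.pi),
      IsProbabilityMeasure μ ∧ IsMarkovChain μ ℱ K s fun n ω => ω n := by
  let κ : (n : ℕ) → ProbabilityTheory.Kernel (Finset.Iic n → S) S := fun n =>
    (ProbabilityTheory.Kernel.ofFunOfCountable fun s => (K s).toMeasure).comap
      (fun x => x ⟨n, Finset.mem_Iic.2 le_rfl⟩) (measurable_pi_apply _)
  have hκ : ∀ n, ProbabilityTheory.IsMarkovKernel (κ n) := fun n =>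
    ⟨fun x => PMF.toMeasure.isProbabilityMeasure (K (x ⟨n, Finset.mem_Iic.2 le_rfl⟩))⟩
  let x₀ : Finset.Iic 0 → S := fun _ => s
  refine ⟨ProbabilityTheory.Kernel.traj (X := fun _ => S) κ 0 x₀,
    Filtration.piLE (X := fun _ => S), inferInstance, ?_, ?_, ?_⟩
  · intro n
    have heval : Measurable fun x : Set.Iic n → S => x ⟨n, Set.mem_Iic.2 le_rfl⟩ :=
      measurable_pi_apply _
    exact heval.comp (comap_measurable (Preorder.restrictLe (π := fun _ => S) n))
  · have hmap := ProbabilityTheory.Kernel.traj_map_frestrictLe_apply (X := fun _ => S)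
      (κ := κ) 0 0 x₀
    rw [ProbabilityTheory.Kernel.partialTraj_self, ProbabilityTheory.Kernel.id_apply] at hmap
    have hset : MeasurableSet {x : Finset.Iic 0 → S | x ⟨0, Finset.mem_Iic.2 le_rfl⟩ = s} :=
      measurableSet_eq_fun (measurable_pi_apply _) measurable_const
    have hdirac : ∀ᵐ x ∂Measure.dirac x₀, x ⟨0, Finset.mem_Iic.2 le_rfl⟩ = s :=
      (ae_dirac_iff hset).2 rfl
    rw [← hmap] at hdirac
    exact ae_of_ae_map (Preorder.measurable_frestrictLe 0).aemeasurable hdirac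
  · intro n t
    have hB : MeasurableSet {ω : ℕ → S | ω (n + 1) = t} :=
      measurableSet_eq_fun (measurable_pi_apply (n + 1)) measurable_const
    filter_upwards [ProbabilityTheory.Kernel.condExp_traj (X := fun _ => S) (κ := κ)
      (Nat.zero_le n) (x₀ := x₀) ((integrable_const (1 : ℝ)).indicator hB)] with ω hω
    rw [hω, integral_indicator hB, setIntegral_const, smul_eq_mul, mul_one, Measure.real]
    congr 1
    have hsucc := congrArg (fun η => η (Preorder.frestrictLe n ω) {t})
      (ProbabilityTheory.Kernel.map_traj_succ_self (X := fun _ => S) (κ := κ) (a := n))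
    rw [ProbabilityTheory.Kernel.map_apply _ (measurable_pi_apply _),
      Measure.map_apply (measurable_pi_apply _) (.singleton t)] at hsucc
    exact hsucc.trans ((K (ω n)).toMeasure_apply_singleton t (.singleton t))

/-- Blackwell's characterisation, absorbing-state specialisation (Theorem 5.1). -/
theorem stmt_4 {S : Type} [Countable S] [MeasurableSpace S] [DiscreteMeasurableSpace S]
    (K : S → PMF S) (s₀ : S) (habs : K s₀ = PMF.pure s₀) :
    (∀ s : S, ∀ (Ω : Type) (m : MeasurableSpace Ω) (μ : Measure Ω),
        IsProbabilityMeasure μ → ∀ (ℱ : Filtration ℕ m) (X : ℕ → Ω → S),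
          IsMarkovChain μ ℱ K s X → μ {ω | ∃ n, X n ω = s₀} = 1)
      ↔ (∀ V : S → ℝ, (∃ C : ℝ, ∀ s, |V s| ≤ C) →
          (∀ s : S, s ≠ s₀ → ∑' t : S, ((K s) t).toReal * V t = V s) →
          ∀ s t : S, V s = V t) := by
  constructor
  · rintro hit V ⟨C, hC⟩ hharm
    have hV : ∀ s, ∑' t, (K s t).toReal * V t = V s := by
      intro s
      by_cases hs : s = s₀
      · subst hs
        rw [tsum_eq_single s]
        · simp [habs]
        · intro t ht
          simp [habs, ht]
      · exact hharm s hs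
    have hVneg : ∀ s, ∑' t, (K s t).toReal * -V t = -V s := fun s => by
      simp_rw [mul_neg, tsum_neg, hV]
    have hconst : ∀ s, V s = V s₀ := by
      intro s
      obtain ⟨μ, ℱ, hμ, hX⟩ := exists_isMarkovChain K s
      have hsup := (hX.measure_exists_eq_iSup habs).symm.trans (hit s _ _ μ hμ ℱ _ hX)
      have hge := le_of_harmonic_of_iSup_stepDist_eq_one hsup hC hV
      have hle := le_of_harmonic_of_iSup_stepDist_eq_one hsup (V := fun t => -V t)
        (fun t => (abs_neg (V t)).trans_le (hC t)) hVneg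
      linarith
    exact fun s t => (hconst s).trans (hconst t).symm
  · intro hconst s Ω m μ hμ ℱ X hX
    have hle : ∀ s, ⨆ n, stepDist K n s s₀ ≤ 1 := fun s =>
      iSup_le fun n => (stepDist K n s).coe_le_one s₀
    have hne : ∀ s, ⨆ n, stepDist K n s s₀ ≠ ⊤ := fun s =>
      ne_top_of_le_ne_top ENNReal.one_ne_top (hle s)
    have heq := hconst (fun s => (⨆ n, stepDist K n s s₀).toReal)
      ⟨1, fun s => by
        rw [abs_of_nonneg ENNReal.toReal_nonneg]
        exact ENNReal.toReal_le_of_le_ofReal zero_le_one (by simpa using hle s)⟩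
      (fun s _ => by
        simp_rw [← ENNReal.toReal_mul]
        rw [← ENNReal.tsum_toReal_eq
          (fun t => ENNReal.mul_ne_top ((K s).apply_ne_top t) (hne t)),
          tsum_mul_iSup_stepDist habs]) s s₀
    rw [hX.measure_exists_eq_iSup habs, (ENNReal.toReal_eq_toReal_iff' (hne s) (hne s₀)).1 heq]
    simp [stepDist_absorbing habs]
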